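/- arXiv:1810.04248 — 2 statements merged into one kernel-verified Lean document; each statement's English description precedes it below -/
import Mathlib

section
/- Let f be a maximal flag in F^n with label σ, and let p_σ be the number of ascents of σ. Then the number of flags g with g ⊆ f and minlabel(g) = σ equals 2^{p_σ} if σ is not the identity permutation, and equals 2^{n−1} − 1 if σ is the identity permutation. -/
open Matrix

variable {n : ℕ} {F : Type} [Field F]

/-- `(r, j)` is a pivot position of `M`: the entry `M r j` is nonzero and all entries of
column `j` strictly below row `r` vanish (i.e. `r` is the largest row index with `M r j ≠ 0`). -/
def IsPivot (M : Matrix (Fin n) (Fin n) F) (r j : Fin n) : Prop :=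
  M r j ≠ 0 ∧ ∀ r' : Fin n, r < r' → M r' j = 0

/-- The span of the first `j` columns of `M` (columns with index `< j` in 0-based indexing). -/
def colSpan (M : Matrix (Fin n) (Fin n) F) (j : ℕ) : Submodule F (Fin n → F) :=
  Submodule.span F ((fun i : Fin n => Mᵀ i) '' {i : Fin n | (i : ℕ) < j})

/-- A flag: a nonempty finite set of proper nonzero subspaces of `F^n` forming a chain. -/
def IsFlag (g : Set (Submodule F (Fin n → F))) : Prop :=
  g.Finite ∧ g.Nonempty ∧ IsChain (· ≤ ·) g ∧ ∀ V ∈ g, V ≠ ⊥ ∧ V ≠ ⊤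

/-- A maximal flag: a flag containing a subspace of every dimension `1,…,n-1`. -/
def IsMaximalFlag (f : Set (Submodule F (Fin n → F))) : Prop :=
  IsFlag f ∧ ∀ j : ℕ, 1 ≤ j → j ≤ n - 1 → ∃ V ∈ f, Module.finrank F V = j

/-- Conditions (i)–(iii) for a matrix representation of a flag `f`:
(i) for every `V ∈ f` the first `dim V` columns of `M` span `V`, and all `n` columns span `F^n`;
(ii) every pivot entry equals `1`;
(iii) entries in the same row as a pivot and strictly to its right vanish. -/
def IsRep (f : Set (Submodule F (Fin n → F))) (M : Matrix (Fin n) (Fin n) F) : Prop :=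
  (∀ V ∈ f, colSpan M (Module.finrank F V) = V) ∧
  colSpan M n = ⊤ ∧
  (∀ r j : Fin n, IsPivot M r j → M r j = 1) ∧
  (∀ r j j' : Fin n, IsPivot M r j → j < j' → M r j' = 0)

/-- Columns `i` and `i'` lie in the same block of the block decomposition induced by the
flag `g` (blocks are the intervals of columns between consecutive dimensions of members of `g`). -/
def SameBlock (g : Set (Submodule F (Fin n → F))) (i i' : Fin n) : Prop :=
  ∀ V ∈ g, ((i : ℕ) < Module.finrank F V ↔ (i' : ℕ) < Module.finrank F V)

/-- The minimal matrix representation of a flag `g`: conditions (i)–(iii) together with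
(iv) within each block, entries in the same row as a pivot of the block and strictly to its left
within the block vanish; (v) within each block, pivot row indices strictly increase. -/
def IsMinRep (g : Set (Submodule F (Fin n → F))) (M : Matrix (Fin n) (Fin n) F) : Prop :=
  IsRep g M ∧
  (∀ r i i' : Fin n, SameBlock g i i' → IsPivot M r i → i' < i → M r i' = 0) ∧
  (∀ r r' i i' : Fin n, SameBlock g i i' → IsPivot M r i → IsPivot M r' i' → i < i' → r < r')

/-- `σ` is the label of the maximal flag `f`: `σ j` is the pivot row of the `j`-th column of
the minimal matrix representation of `f`. -/
def IsLabel (f : Set (Submodule F (Fin n → F))) (σ : Equiv.Perm (Fin n)) : Prop :=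
  ∃ M : Matrix (Fin n) (Fin n) F, IsRep f M ∧ ∀ j : Fin n, IsPivot M (σ j) j

/-- Strict lexicographic order on permutations in one-line notation `(σ 0, …, σ (n-1))`. -/
def LexLt {n : ℕ} (σ τ : Equiv.Perm (Fin n)) : Prop :=
  ∃ j : Fin n, (∀ i : Fin n, i < j → σ i = τ i) ∧ σ j < τ j

/-- `σ` is the lexicographically least label among the labels of maximal flags containing `g`. -/
def IsMinlabel (g : Set (Submodule F (Fin n → F))) (σ : Equiv.Perm (Fin n)) : Prop :=
  (∃ f, IsMaximalFlag f ∧ g ⊆ f ∧ IsLabel f σ) ∧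
  ∀ (f : Set (Submodule F (Fin n → F))) (τ : Equiv.Perm (Fin n)),
    IsMaximalFlag f → g ⊆ f → IsLabel f τ → σ = τ ∨ LexLt σ τ

/-- `t` is a (0-based) ascent of `σ`: `σ t < σ (t+1)`.  (In the 1-based indexing of the paper
this corresponds to the ascent `(σ(t+1), σ(t+2))` at position `t+1`.) -/
def Ascent {n : ℕ} (σ : Equiv.Perm (Fin n)) (t : ℕ) : Prop :=
  ∃ h : t + 1 < n, σ ⟨t, Nat.lt_of_succ_lt h⟩ < σ ⟨t + 1, h⟩

/-- `σ` is the decreasing permutation `σ(j) = n + 1 - j` (in 0-based indexing, `n - 1 - j`). -/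
def IsDecreasing {n : ℕ} (σ : Equiv.Perm (Fin n)) : Prop :=
  ∀ j : Fin n, (σ j : ℕ) = n - 1 - (j : ℕ)

lemma IsPivot.row_unique {M : Matrix (Fin n) (Fin n) F} {r r' j : Fin n}
    (h : IsPivot M r j) (h' : IsPivot M r' j) : r = r' := by
  rcases lt_trichotomy r r' with hlt | heq | hgt
  · exact absurd (h.2 _ hlt) h'.1
  · exact heq
  · exact absurd (h'.2 _ hgt) h.1

lemma col_mem_colSpan (M : Matrix (Fin n) (Fin n) F) {d : ℕ} {i : Fin n} (h : (i : ℕ) < d) :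
    Mᵀ i ∈ colSpan M d :=
  Submodule.subset_span ⟨i, h, rfl⟩

lemma colSpan_mono (M : Matrix (Fin n) (Fin n) F) : Monotone (colSpan M) := fun _ _ h =>
  Submodule.span_mono (Set.image_mono fun _ hi => lt_of_lt_of_le hi h)

/-- The leading row of a vector in the span of columns with distinct pivot rows is one of
these pivot rows. -/
lemma exists_eq_of_mem_colSpan {M : Matrix (Fin n) (Fin n) F} {σ : Equiv.Perm (Fin n)}
    (hM : ∀ j, IsPivot M (σ j) j) {d : ℕ} {v : Fin n → F} (hv : v ∈ colSpan M d) {r : Fin n}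
    (hr : v r ≠ 0) (hr' : ∀ r', r < r' → v r' = 0) : ∃ i : Fin n, (i : ℕ) < d ∧ r = σ i := by
  obtain ⟨c, hc, rfl⟩ := (Finsupp.mem_span_image_iff_linearCombination F).1 hv
  have hval : ∀ s, Finsupp.linearCombination F (fun i : Fin n => Mᵀ i) c s
      = ∑ i ∈ c.support, c i * M s i := fun s => by
    simp [Finsupp.linearCombination_apply, Finsupp.sum, Finset.sum_apply]
  have hne : c.support.Nonempty := by
    rw [Finset.nonempty_iff_ne_empty]
    intro h
    rw [hval, h] at hr
    simp at hr
  obtain ⟨i, hi, hmax⟩ := c.support.exists_max_image σ hne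
  refine ⟨i, hc hi, ?_⟩
  have hlow : ∀ s, σ i < s → Finsupp.linearCombination F (fun i : Fin n => Mᵀ i) c s = 0 :=
    fun s hs => by
      rw [hval]
      exact Finset.sum_eq_zero fun k hk => by
        rw [(hM k).2 s ((hmax k hk).trans_lt hs), mul_zero]
  have htop : Finsupp.linearCombination F (fun i : Fin n => Mᵀ i) c (σ i) ≠ 0 := by
    rw [hval, Finset.sum_eq_single_of_mem i hi]
    · exact mul_ne_zero (Finsupp.mem_support_iff.1 hi) (hM i).1
    · intro k hk hki
      rw [(hM k).2 (σ i) (lt_of_le_of_ne (hmax k hk) (σ.injective.ne hki)), mul_zero]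
  rcases lt_trichotomy r (σ i) with h | h | h
  · exact absurd (hr' _ h) htop
  · exact h
  · exact absurd (hlow _ h) hr

lemma finrank_colSpan {M : Matrix (Fin n) (Fin n) F} (hM : colSpan M n = ⊤) {d : ℕ}
    (hd : d ≤ n) : Module.finrank F (colSpan M d) = d := by
  have hli : LinearIndependent F (fun i : Fin n => Mᵀ i) := by
    refine linearIndependent_of_top_le_span_of_card_eq_finrank ?_ (by simp)
    rw [← hM]
    exact Submodule.span_mono (Set.image_subset_range _ _)
  have hsub : LinearIndependent F (fun i : {i : Fin n | (i : ℕ) < d} => Mᵀ i) :=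
    hli.comp _ Subtype.val_injective
  rw [colSpan, Set.image_eq_range, finrank_span_eq_card hsub, ← Nat.card_eq_fintype_card]
  rw [Nat.card_coe_set_eq, Set.ncard_eq_toFinset_card']
  simp [Fin.card_filter_val_lt, hd]

lemma IsFlag.eq_of_finrank_eq {f : Set (Submodule F (Fin n → F))} (hf : IsFlag f)
    {V W : Submodule F (Fin n → F)} (hV : V ∈ f) (hW : W ∈ f)
    (h : Module.finrank F V = Module.finrank F W) : V = W := by
  rcases hf.2.2.1.total hV hW with hle | hle
  · exact Submodule.eq_of_le_of_finrank_eq hle h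
  · exact (Submodule.eq_of_le_of_finrank_eq hle h.symm).symm

lemma IsFlag.finrank_pos {f : Set (Submodule F (Fin n → F))} (hf : IsFlag f)
    {V : Submodule F (Fin n → F)} (hV : V ∈ f) : 0 < Module.finrank F V := by
  rw [Nat.pos_iff_ne_zero, Ne, Submodule.finrank_eq_zero]
  exact (hf.2.2.2 V hV).1

lemma IsFlag.finrank_lt {f : Set (Submodule F (Fin n → F))} (hf : IsFlag f)
    {V : Submodule F (Fin n → F)} (hV : V ∈ f) : Module.finrank F V < n := by
  simpa using Submodule.finrank_lt (hf.2.2.2 V hV).2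

lemma IsFlag.subset {f g : Set (Submodule F (Fin n → F))} (hf : IsFlag f) (hg : g ⊆ f)
    (hne : g.Nonempty) : IsFlag g :=
  ⟨hf.1.subset hg, hne, hf.2.2.1.mono hg, fun V hV => hf.2.2.2 V (hg hV)⟩

/-- The set of spans of the first `d` columns of an invertible matrix, for `0 < d < n`. -/
def colFlag (M : Matrix (Fin n) (Fin n) F) : Set (Submodule F (Fin n → F)) :=
  colSpan M '' Set.Ioo 0 n

lemma isMaximalFlag_colFlag (hn : 2 ≤ n) {M : Matrix (Fin n) (Fin n) F}
    (hM : colSpan M n = ⊤) : IsMaximalFlag (colFlag M) := by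
  refine ⟨⟨(Set.finite_Ioo 0 n).image _, ⟨_, 1, ⟨by omega, by omega⟩, rfl⟩, ?_, ?_⟩, ?_⟩
  · rintro _ ⟨d, -, rfl⟩ _ ⟨e, -, rfl⟩ -
    exact (le_total d e).imp (fun h => colSpan_mono M h) (fun h => colSpan_mono M h)
  · rintro _ ⟨d, ⟨h0, h1⟩, rfl⟩
    have hd := finrank_colSpan hM h1.le
    constructor
    · intro h
      rw [h, finrank_bot] at hd
      omega
    · intro h
      rw [h, finrank_top, Module.finrank_fin_fun] at hd
      omega
  · intro j h1 h2
    exact ⟨_, ⟨j, ⟨by omega, by omega⟩, rfl⟩, finrank_colSpan hM (by omega)⟩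

lemma isLabel_colFlag {M : Matrix (Fin n) (Fin n) F} (hM : colSpan M n = ⊤)
    {σ : Equiv.Perm (Fin n)} (hpiv : ∀ j, IsPivot M (σ j) j) (hone : ∀ j, M (σ j) j = 1)
    (hzero : ∀ j j', j < j' → M (σ j) j' = 0) : IsLabel (colFlag M) σ := by
  refine ⟨M, ⟨?_, hM, ?_, ?_⟩, hpiv⟩
  · rintro _ ⟨d, ⟨-, h1⟩, rfl⟩
    rw [finrank_colSpan hM h1.le]
  · intro r j h
    rw [h.row_unique (hpiv j), hone]
  · intro r j j' h hj
    rw [h.row_unique (hpiv j), hzero j j' hj]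

/-- Exchange columns `a` and `b`, then clear with the new column `a` the entry of the new
column `b` in row `s`. -/
def swapCols (M : Matrix (Fin n) (Fin n) F) (s a b : Fin n) : Matrix (Fin n) (Fin n) F :=
  fun r i => if i = a then M r b else if i = b then M r a - M s a * M r b else M r i

lemma colSpan_swapCols (M : Matrix (Fin n) (Fin n) F) (s : Fin n) {a b : Fin n}
    (hab : (b : ℕ) = a + 1) {d : ℕ} (hd : d ≠ b) :
    colSpan (swapCols M s a b) d = colSpan M d := by
  have hne : b ≠ a := fun h => by simp [h] at hab
  have hA : (swapCols M s a b)ᵀ a = Mᵀ b := by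
    ext r; simp [swapCols]
  have hB : (swapCols M s a b)ᵀ b = Mᵀ a - M s a • Mᵀ b := by
    ext r; simp [swapCols, hne]
  have hO : ∀ i, i ≠ a → i ≠ b → (swapCols M s a b)ᵀ i = Mᵀ i := fun i h1 h2 => by
    ext r; simp [swapCols, h1, h2]
  apply le_antisymm
  · refine Submodule.span_le.2 ?_
    rintro _ ⟨i, hi, rfl⟩
    simp only [Set.mem_ofPred_eq] at hi
    show (swapCols M s a b)ᵀ i ∈ colSpan M d
    by_cases h1 : i = a
    · subst h1
      rw [hA]
      exact col_mem_colSpan M (by omega)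
    by_cases h2 : i = b
    · subst h2
      rw [hB]
      exact sub_mem (col_mem_colSpan M (by omega))
        (Submodule.smul_mem _ _ (col_mem_colSpan M (by omega)))
    rw [hO i h1 h2]
    exact col_mem_colSpan M hi
  · refine Submodule.span_le.2 ?_
    rintro _ ⟨i, hi, rfl⟩
    simp only [Set.mem_ofPred_eq] at hi
    show Mᵀ i ∈ colSpan (swapCols M s a b) d
    by_cases h1 : i = a
    · subst h1
      have : Mᵀ i = (swapCols M s i b)ᵀ b + M s i • (swapCols M s i b)ᵀ i := by
        rw [hA, hB]; simp
      rw [this]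
      exact add_mem (col_mem_colSpan _ (by omega))
        (Submodule.smul_mem _ _ (col_mem_colSpan _ (by omega)))
    by_cases h2 : i = b
    · subst h2
      rw [← hA]
      exact col_mem_colSpan _ (by omega)
    rw [← hO i h1 h2]
    exact col_mem_colSpan _ hi

/-- If a descent `a` of the label `σ` of `f` is not the dimension of a member of `g`, then `g` is
contained in a maximal flag whose label exchanges the values of `σ` at the descent. -/
lemma exists_label_swap (hn : 2 ≤ n) {f g : Set (Submodule F (Fin n → F))} (hf : IsMaximalFlag f)
    {σ : Equiv.Perm (Fin n)} (hσ : IsLabel f σ) (hg : g ⊆ f) {a b : Fin n}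
    (hab : (b : ℕ) = a + 1) (hlt : σ b < σ a) (hgb : ∀ V ∈ g, Module.finrank F V ≠ b) :
    ∃ f', IsMaximalFlag f' ∧ g ⊆ f' ∧ IsLabel f' (σ * Equiv.swap a b) := by
  obtain ⟨M, ⟨hV, htop, hone, hzero⟩, hpiv⟩ := hσ
  have hlab : a < b := by rw [Fin.lt_def]; omega
  have htop' : colSpan (swapCols M (σ b) a b) n = ⊤ := by
    rw [colSpan_swapCols M _ hab (by omega), htop]
  have hval : ∀ j, (σ * Equiv.swap a b) j = if j = a then σ b else if j = b then σ a else σ j := by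
    intro j
    rw [Equiv.Perm.mul_apply, Equiv.swap_apply_def]
    split_ifs <;> rfl
  have hz : ∀ j j', j < j' → M (σ j) j' = 0 := fun j j' h => hzero _ _ _ (hpiv j) h
  have ho : ∀ j, M (σ j) j = 1 := fun j => hone _ _ (hpiv j)
  have hone' : ∀ j, swapCols M (σ b) a b ((σ * Equiv.swap a b) j) j = 1 := by
    intro j
    rw [hval]
    unfold swapCols
    split_ifs with h1 h2
    · exact ho b
    · rw [ho, hz a b hlab]; simp
    · exact ho j
  refine ⟨colFlag (swapCols M (σ b) a b), isMaximalFlag_colFlag hn htop', ?_,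
    isLabel_colFlag htop' ?_ hone' ?_⟩
  · intro V hVg
    refine ⟨Module.finrank F V, ⟨hf.1.finrank_pos (hg hVg), hf.1.finrank_lt (hg hVg)⟩, ?_⟩
    rw [colSpan_swapCols M _ hab (hgb V hVg), hV V (hg hVg)]
  · intro j
    refine ⟨by rw [hone']; exact one_ne_zero, ?_⟩
    intro r hr
    rw [hval] at hr
    unfold swapCols
    split_ifs at hr ⊢ with h1 h2
    · exact (hpiv b).2 r hr
    · rw [(hpiv a).2 r hr, (hpiv b).2 r (hlt.trans hr)]; simp
    · exact (hpiv j).2 r hr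
  · intro j j' hj
    have hjv : (j : ℕ) < j' := hj
    rw [hval]
    simp only [swapCols]
    by_cases hja : j = a
    · subst hja
      rw [if_pos rfl, if_neg hj.ne']
      by_cases hjb : j' = b
      · rw [if_pos hjb, ho b]
        simp
      · rw [if_neg hjb]
        exact hz b j' (by rw [Fin.lt_def]; have := Fin.val_ne_iff.2 hjb; omega)
    rw [if_neg hja]
    by_cases hjb : j = b
    · subst hjb
      have hj'a : j' ≠ a := (hlab.trans hj).ne'
      rw [if_pos rfl, if_neg hj'a, if_neg hj.ne']
      exact hz a j' (hlab.trans hj)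
    rw [if_neg hjb]
    by_cases hj'a : j' = a
    · subst hj'a
      rw [if_pos rfl]
      exact hz j b (hj.trans hlab)
    rw [if_neg hj'a]
    by_cases hj'b : j' = b
    · subst hj'b
      have hlt' : j < a := by rw [Fin.lt_def]; have := Fin.val_ne_iff.2 hja; omega
      rw [if_pos rfl, hz j a hlt', hz j j' hj]
      simp
    · rw [if_neg hj'b]
      exact hz j j' hj

lemma not_lexLt_self_swap {σ : Equiv.Perm (Fin n)} {a b : Fin n} (hab : a < b)
    (hlt : σ b < σ a) : ¬ (σ = σ * Equiv.swap a b ∨ LexLt σ (σ * Equiv.swap a b)) := by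
  have ha : (σ * Equiv.swap a b) a = σ b := by simp
  rintro (h | ⟨j, hj, hjlt⟩)
  · rw [← h] at ha
    exact hlt.ne ha.symm
  · rcases lt_trichotomy j a with h | h | h
    · rw [Equiv.Perm.mul_apply, Equiv.swap_apply_of_ne_of_ne h.ne (h.trans hab).ne] at hjlt
      exact lt_irrefl _ hjlt
    · subst h
      rw [ha] at hjlt
      exact lt_asymm hlt hjlt
    · have := hj a h
      rw [ha] at this
      exact hlt.ne this.symm

lemma lt_of_forall_ascent {σ : Equiv.Perm (Fin n)} {j : Fin n} :
    ∀ {m : ℕ} (hm : m < n), (j : ℕ) < m → (∀ t, (j : ℕ) ≤ t → t < m → Ascent σ t) →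
      σ j < σ ⟨m, hm⟩ := by
  intro m
  induction m with
  | zero => intro _ h; omega
  | succ m ih =>
    intro hm hjm h
    obtain ⟨_, hlt⟩ := h m (by omega) (by omega)
    rcases Nat.lt_or_ge (j : ℕ) m with hj | hj
    · exact (ih (by omega) hj fun t h1 h2 => h t h1 (by omega)).trans hlt
    · have : j = ⟨m, by omega⟩ := Fin.ext (by simp; omega)
      rwa [this]

/-- If the dimensions missing from `g` are ascents of the label `σ` of `f ⊇ g`, then `σ` is
lexicographically least among the labels of maximal flags containing `g`. -/
lemma label_le_of_ascents {f g f' : Set (Submodule F (Fin n → F))}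
    {σ τ : Equiv.Perm (Fin n)} (hσ : IsLabel f σ) (hg : g ⊆ f) (hg' : g ⊆ f')
    (hτ : IsLabel f' τ)
    (h : ∀ t, t + 1 < n → (∀ V ∈ g, Module.finrank F V ≠ t + 1) → Ascent σ t) :
    σ = τ ∨ LexLt σ τ := by
  obtain ⟨M, ⟨hM, -⟩, hMp⟩ := hσ
  obtain ⟨N, ⟨hN, -⟩, hNp⟩ := hτ
  by_cases heq : σ = τ
  · exact Or.inl heq
  right
  have hex : (Finset.univ.filter fun j => σ j ≠ τ j).Nonempty := by
    by_contra hcon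
    refine heq (Equiv.ext fun j => ?_)
    by_contra hj
    exact hcon ⟨j, by simpa using hj⟩
  obtain ⟨j, hj, hmin⟩ := Finset.exists_min_image _ id hex
  have hjne : σ j ≠ τ j := by simpa using hj
  have hagree : ∀ i, i < j → σ i = τ i := fun i hi => by
    by_contra hne
    exact absurd (hmin i (by simpa using hne)) (not_le.2 hi)
  refine ⟨j, hagree, ?_⟩
  obtain ⟨k, hk⟩ := σ.surjective (τ j)
  have hjk : j < k := by
    rcases lt_trichotomy j k with h1 | h1 | h1
    · exact h1
    · subst h1; exact absurd hk hjne
    · rw [hagree k h1] at hk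
      exact absurd (τ.injective hk) h1.ne
  rw [← hk]
  refine lt_of_forall_ascent k.2 hjk fun t h1 h2 => h t (by omega) fun V hV hVt => ?_
  have hmem : Nᵀ j ∈ colSpan M (t + 1) := by
    rw [← hVt, hM V (hg hV), ← hN V (hg' hV), hVt]
    exact col_mem_colSpan N (by omega)
  obtain ⟨i, hi, hij⟩ := exists_eq_of_mem_colSpan hMp hmem (hNp j).1 (hNp j).2
  rw [← hk] at hij
  have := σ.injective hij
  omega

lemma isMinlabel_iff (hn : 2 ≤ n) {f g : Set (Submodule F (Fin n → F))} (hf : IsMaximalFlag f)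
    {σ : Equiv.Perm (Fin n)} (hσ : IsLabel f σ) (hg : g ⊆ f) :
    IsMinlabel g σ ↔ {V ∈ f | ¬ Ascent σ (Module.finrank F V - 1)} ⊆ g := by
  constructor
  · rintro ⟨-, hmin⟩ V ⟨hV, hasc⟩
    by_contra hVg
    have hpos := hf.1.finrank_pos hV
    have hlt := hf.1.finrank_lt hV
    have hle : Module.finrank F V - 1 + 1 = Module.finrank F V := by omega
    let a : Fin n := ⟨Module.finrank F V - 1, by omega⟩
    let b : Fin n := ⟨Module.finrank F V - 1 + 1, by omega⟩
    have hab : a < b := by rw [Fin.lt_def]; simp [a, b]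
    have hba : σ b < σ a := by
      refine lt_of_le_of_ne (not_lt.1 fun h => hasc ⟨by omega, h⟩) (σ.injective.ne hab.ne')
    obtain ⟨f', hf', hgf', hl⟩ := exists_label_swap hn hf hσ hg (a := a) (b := b) rfl hba
      fun W hW hWb => hVg (by
        rwa [hf.1.eq_of_finrank_eq hV (hg hW) (by rw [hWb, ← hle])])
    exact not_lexLt_self_swap hab hba (hmin f' _ hf' hgf' hl)
  · intro h
    refine ⟨⟨f, hf, hg, hσ⟩, fun f' τ _ hgf' hτ => label_le_of_ascents hσ hg hgf' hτ ?_⟩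
    intro t ht hmiss
    by_contra hasc
    obtain ⟨V, hV, hVt⟩ := hf.2 (t + 1) (by omega) (by omega)
    exact hmiss V (h ⟨hV, by rwa [hVt]⟩) hVt

lemma ncard_setOf_subset_subset {α : Type*} {s t : Set α} (ht : t.Finite) (hst : s ⊆ t) :
    {u | u ⊆ t ∧ s ⊆ u}.ncard = 2 ^ (t \ s).ncard := by
  rw [← Set.ncard_powerset _ (ht.subset Set.sdiff_subset)]
  refine Set.ncard_congr (fun u _ => u \ s) ?_ ?_ ?_
  · rintro u ⟨h1, -⟩
    exact Set.sdiff_subset_sdiff_left h1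
  · rintro u v ⟨-, hu⟩ ⟨-, hv⟩ h
    rw [← Set.sdiff_union_of_subset hu, ← Set.sdiff_union_of_subset hv, h]
  · intro u hu
    refine ⟨u ∪ s, ⟨Set.union_subset (hu.trans Set.sdiff_subset) hst, Set.subset_union_right⟩, ?_⟩
    rw [Set.union_sdiff_right]
    exact (Set.subset_sdiff.1 hu).2.sdiff_eq_left

lemma IsMaximalFlag.ncard_ascents {f : Set (Submodule F (Fin n → F))} (hf : IsMaximalFlag f)
    (σ : Equiv.Perm (Fin n)) :
    (f \ {V ∈ f | ¬ Ascent σ (Module.finrank F V - 1)}).ncard = {t | Ascent σ t}.ncard := by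
  refine Set.ncard_congr (fun V _ => Module.finrank F V - 1) ?_ ?_ ?_
  · rintro V ⟨hV, h⟩
    by_contra hasc
    exact h ⟨hV, hasc⟩
  · rintro V W ⟨hV, -⟩ ⟨hW, -⟩ h
    have h1 := hf.1.finrank_pos hV
    have h2 := hf.1.finrank_pos hW
    exact hf.1.eq_of_finrank_eq hV hW (by omega)
  · intro t ht
    obtain ⟨h, -⟩ := id ht
    obtain ⟨V, hV, hVt⟩ := hf.2 (t + 1) (by omega) (by omega)
    have hVt' : Module.finrank F V - 1 = t := by omega
    exact ⟨V, ⟨hV, fun hasc => hasc.2 (by rwa [hVt'])⟩, hVt'⟩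

lemma eq_one_of_forall_ascent {σ : Equiv.Perm (Fin n)} (h : ∀ t, t + 1 < n → Ascent σ t) :
    σ = 1 := by
  have hmono : StrictMono σ := fun i j hij =>
    lt_of_forall_ascent j.2 hij fun t _ ht => h t (by omega)
  exact Equiv.ext fun i => congrFun (hmono.range_inj strictMono_id |>.1 (by simp)) i

/-- for a maximal flag `f` with label `σ`, the number of faces of `f` lying in
`X_σ` is `2^{p_σ}` when `σ` is not the identity, and `2^{n-1} - 1` when `σ` is the identity
(`p_σ` being the number of ascents of `σ`). -/
theorem card_faces_in_X_sigma
    [Fintype F] (hn : 2 ≤ n)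
    (f : Set (Submodule F (Fin n → F))) (hf : IsMaximalFlag f)
    (σ : Equiv.Perm (Fin n)) (hσ : IsLabel f σ) :
    (σ ≠ 1 →
      {g : Set (Submodule F (Fin n → F)) | IsFlag g ∧ g ⊆ f ∧ IsMinlabel g σ}.ncard =
        2 ^ {t : ℕ | Ascent σ t}.ncard) ∧
    (σ = 1 →
      {g : Set (Submodule F (Fin n → F)) | IsFlag g ∧ g ⊆ f ∧ IsMinlabel g σ}.ncard =
        2 ^ (n - 1) - 1) := by
  have hset : {g : Set (Submodule F (Fin n → F)) | IsFlag g ∧ g ⊆ f ∧ IsMinlabel g σ} =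
      {g | g ⊆ f ∧ {V ∈ f | ¬ Ascent σ (Module.finrank F V - 1)} ⊆ g} \ {∅} := by
    ext g
    constructor
    · rintro ⟨hflag, hg, hmin⟩
      exact ⟨⟨hg, (isMinlabel_iff hn hf hσ hg).1 hmin⟩, hflag.2.1.ne_empty⟩
    · rintro ⟨⟨hg, hmin⟩, hne⟩
      exact ⟨hf.1.subset hg (Set.nonempty_iff_ne_empty.2 hne), hg,
        (isMinlabel_iff hn hf hσ hg).2 hmin⟩
  have hcard := ncard_setOf_subset_subset hf.1.1
    (Set.sep_subset f fun V => ¬ Ascent σ (Module.finrank F V - 1))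
  rw [hf.ncard_ascents σ] at hcard
  rw [hset]
  constructor
  · intro hne
    rw [Set.sdiff_singleton_eq_self, hcard]
    rintro ⟨-, hempty⟩
    refine hne (eq_one_of_forall_ascent fun t ht => ?_)
    by_contra hasc
    obtain ⟨V, hV, hVt⟩ := hf.2 (t + 1) (by omega) (by omega)
    exact hempty ⟨hV, by rwa [hVt]⟩
  · rintro rfl
    have hasc : ∀ t, t + 1 < n → Ascent (1 : Equiv.Perm (Fin n)) t := fun t ht =>
      ⟨ht, by simp [Fin.lt_def]⟩
    rw [Set.ncard_sdiff_singleton_of_mem, hcard]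
    · have : {t | Ascent (1 : Equiv.Perm (Fin n)) t} = Set.Iio (n - 1) := by
        ext t
        exact ⟨fun ⟨h, _⟩ => by simp; omega, fun h => hasc t (by simp at h; omega)⟩
      rw [this, Set.ncard_eq_toFinset_card']
      simp
    · refine ⟨Set.empty_subset f, ?_⟩
      rintro V ⟨hV, h⟩
      have h1 := hf.1.finrank_pos hV
      have h2 := hf.1.finrank_lt hV
      exact absurd (hasc _ (by omega)) h
end

section
/- Let f be a maximal flag in F^n with minimal matrix representation M, and let g = (V_{d_1} ⊊ ⋯ ⊊ V_{d_k}) be a flag with g ⊆ f, inducing the block decomposition of the columns of M into the blocks of columns d_{j-1}+1,…,d_j for j = 1,…,k+1 (with d_0 = 0 and d_{k+1} = n). If within each such block the pivot row indices of M strictly increase from left to right, then M is also the minimal matrix representation of g. -/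
open Matrix

variable {n : ℕ} {F : Type} [Field F]

/-- A nonzero entry of a matrix lies on or above the pivot of its column. -/
theorem exists_isPivot_of_ne_zero {M : Matrix (Fin n) (Fin n) F} {r j : Fin n}
    (h : M r j ≠ 0) : ∃ r', IsPivot M r' j ∧ r ≤ r' := by
  obtain ⟨r', hle, hmax⟩ := (Set.toFinite {s | M s j ≠ 0}).exists_le_maximal h
  exact ⟨r', ⟨hmax.prop, fun s hs => by_contra fun hne => hmax.not_prop_of_gt hs hne⟩, hle⟩

/-- if `M` is the minimal matrix representation of a maximal flag `f`, `g ⊆ f`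
is a flag, and within each block of the decomposition of the columns of `M` induced by `g`
the pivot row indices strictly increase from left to right, then `M` is also the minimal
matrix representation of `g`. -/
theorem rep_of_maximal_is_minrep_of_face
    [Fintype F] (hn : 2 ≤ n)
    (f : Set (Submodule F (Fin n → F))) (hf : IsMaximalFlag f)
    (M : Matrix (Fin n) (Fin n) F) (hM : IsRep f M)
    (g : Set (Submodule F (Fin n → F))) (hg : IsFlag g) (hgf : g ⊆ f)
    (hpiv : ∀ r r' i i' : Fin n,
      SameBlock g i i' → IsPivot M r i → IsPivot M r' i' → i < i' → r < r') :
    IsMinRep g M := by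
  refine ⟨⟨fun V hV => hM.1 V (hgf hV), hM.2⟩, fun r i i' hblock hr hlt => ?_, hpiv⟩
  by_contra hne
  obtain ⟨r', hr', hle⟩ := exists_isPivot_of_ne_zero hne
  exact (hpiv r' r i' i (fun V hV => (hblock V hV).symm) hr' hr hlt).not_ge hle
end
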